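/- Let μ ∈ ℝ and σ > 0. For t > 0 and u ∈ ℝ define p(t,u) := (2πσ²t)^{−1/2} exp( −(u−μt)² / (2σ²t) ) and its even part E(t,u) := (p(t,u) + p(t,−u))/2. Then for all t > 0 and u ∈ ℝ: ∂²_t E(t,u) − σ² ∂_t ∂²_u E(t,u) − μ² ∂²_u E(t,u) + (σ⁴/4) ∂⁴_u E(t,u) = 0. -/

import Mathlib

noncomputable section

noncomputable def driftDensity (mu sigma t u : ℝ) : ℝ :=
  (Real.sqrt (2 * Real.pi * sigma^2 * t))⁻¹ *
    Real.exp (-(u - mu * t)^2 / (2 * sigma^2 * t))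

noncomputable def evenPart (mu sigma t u : ℝ) : ℝ :=
  (driftDensity mu sigma t u + driftDensity mu sigma t (-u)) / 2

/-- The `n`-th spatial derivative of `driftDensity`, defined by the Hermite-type recursion. -/
def driftDensityDeriv (mu sigma t u : ℝ) : ℕ → ℝ
  | 0 => driftDensity mu sigma t u
  | 1 => -((u - mu * t) / (sigma^2 * t)) * driftDensity mu sigma t u
  | n + 2 => -((u - mu * t) / (sigma^2 * t)) * driftDensityDeriv mu sigma t u (n + 1)
      - (n + 1) / (sigma^2 * t) * driftDensityDeriv mu sigma t u n

theorem driftDensity_neg (mu sigma t u : ℝ) :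
    driftDensity mu sigma t (-u) = driftDensity (-mu) sigma t u := by
  unfold driftDensity
  congr 3
  ring

theorem hasDerivAt_driftDensity_space (mu sigma t u : ℝ) :
    HasDerivAt (driftDensity mu sigma t)
      (-((u - mu * t) / (sigma^2 * t)) * driftDensity mu sigma t u) u := by
  have h := (((((hasDerivAt_id u).sub_const (mu * t)).pow 2).neg.div_const
    (2 * sigma^2 * t)).exp).const_mul (Real.sqrt (2 * Real.pi * sigma^2 * t))⁻¹
  refine h.congr_deriv ?_
  simp only [driftDensity, id, Pi.pow_apply, Pi.neg_apply]
  generalize Real.exp _ = e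
  rw [mul_assoc 2 (sigma^2) t, div_eq_mul_inv, div_eq_mul_inv, mul_inv]
  push_cast
  ring

theorem hasDerivAt_driftDensity_time (mu : ℝ) {sigma t : ℝ} (hsigma : 0 < sigma) (ht : 0 < t)
    (u : ℝ) :
    HasDerivAt (fun s => driftDensity mu sigma s u)
      (-mu * driftDensityDeriv mu sigma t u 1
        + sigma^2 / 2 * driftDensityDeriv mu sigma t u 2) t := by
  have hpos : 0 < 2 * Real.pi * sigma^2 * t := by positivity
  have hsqrt := ((((hasDerivAt_id t).const_mul (2 * Real.pi * sigma^2)).sqrt hpos.ne').inv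
    (Real.sqrt_pos.2 hpos).ne')
  have hexp := ((((((hasDerivAt_id t).const_mul mu).const_sub u).pow 2).neg).div
    ((hasDerivAt_id t).const_mul (2 * sigma^2)) (by simp; constructor <;> positivity)).exp
  refine (hsqrt.mul hexp).congr_deriv ?_
  have hr := Real.sq_sqrt hpos.le
  have hr0 := (Real.sqrt_pos.2 hpos).ne'
  simp only [driftDensityDeriv, driftDensity, id, Pi.pow_apply, Pi.neg_apply,
    Pi.div_apply, Pi.inv_apply]
  generalize Real.exp _ = e
  rw [hr]
  generalize Real.sqrt _ = r at hr hr0 ⊢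
  have hpi : 2 * Real.pi * sigma^2 = r^2 / t := by rw [hr]; field_simp
  rw [hpi]
  push_cast
  field_simp
  ring

theorem hasDerivAt_driftDensityDeriv_space (mu sigma t u : ℝ) (n : ℕ) :
    HasDerivAt (fun v => driftDensityDeriv mu sigma t v n)
      (driftDensityDeriv mu sigma t u (n + 1)) u := by
  have hx : HasDerivAt (fun v => -((v - mu * t) / (sigma^2 * t))) (-(1 / (sigma^2 * t))) u :=
    (((hasDerivAt_id u).sub_const (mu * t)).div_const (sigma^2 * t)).neg
  induction n using Nat.twoStepInduction with
  | zero => exact hasDerivAt_driftDensity_space mu sigma t u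
  | one =>
    refine (hx.mul (hasDerivAt_driftDensity_space mu sigma t u)).congr_deriv ?_
    simp only [driftDensityDeriv]
    push_cast
    ring
  | more n h0 h1 =>
    refine ((hx.mul h1).sub (h0.const_mul ((n + 1) / (sigma^2 * t)))).congr_deriv ?_
    rw [driftDensityDeriv.eq_3 _ _ _ _ (n + 1)]
    push_cast
    ring

theorem hasDerivAt_driftDensityDeriv_time (mu : ℝ) {sigma t : ℝ} (hsigma : 0 < sigma) (ht : 0 < t)
    (u : ℝ) (n : ℕ) :
    HasDerivAt (fun s => driftDensityDeriv mu sigma s u n)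
      (-mu * driftDensityDeriv mu sigma t u (n + 1)
        + sigma^2 / 2 * driftDensityDeriv mu sigma t u (n + 2)) t := by
  have hne : sigma^2 * t ≠ 0 := by positivity
  have hden : HasDerivAt (fun s => sigma^2 * s) (sigma^2 * 1) t :=
    (hasDerivAt_id t).const_mul _
  have hx : HasDerivAt (fun s => -((u - mu * s) / (sigma^2 * s))) _ t :=
    ((((hasDerivAt_id t).const_mul mu).const_sub u).div hden hne).neg
  induction n using Nat.twoStepInduction with
  | zero => exact hasDerivAt_driftDensity_time mu hsigma ht u
  | one =>
    refine (hx.mul (hasDerivAt_driftDensity_time mu hsigma ht u)).congr_deriv ?_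
    simp only [driftDensityDeriv, id]
    push_cast
    field_simp
    ring
  | more n h0 h1 =>
    have hc := (hasDerivAt_const t ((n : ℝ) + 1)).div hden hne
    refine ((hx.mul h1).sub (hc.mul h0)).congr_deriv ?_
    rw [driftDensityDeriv.eq_3 _ _ _ _ (n + 2), driftDensityDeriv.eq_3 _ _ _ _ (n + 1),
      driftDensityDeriv.eq_3 _ _ _ _ n]
    simp only [id, Pi.div_apply]
    push_cast
    field_simp
    ring

theorem iteratedDeriv_evenPart (mu sigma t : ℝ) (n : ℕ) :
    iteratedDeriv n (evenPart mu sigma t) = fun u =>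
      (driftDensityDeriv mu sigma t u n + driftDensityDeriv (-mu) sigma t u n) / 2 := by
  induction n with
  | zero =>
    ext u
    simp [evenPart, driftDensity_neg, driftDensityDeriv]
  | succ n ih =>
    ext u
    rw [iteratedDeriv_succ, ih]
    exact (((hasDerivAt_driftDensityDeriv_space mu sigma t u n).add
      (hasDerivAt_driftDensityDeriv_space (-mu) sigma t u n)).div_const 2).deriv

theorem stmt_9 (mu sigma : ℝ) (hsigma : 0 < sigma) (t : ℝ) (ht : 0 < t) (u : ℝ) :
    iteratedDeriv 2 (fun s => evenPart mu sigma s u) t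
      - sigma^2 * deriv (fun s => iteratedDeriv 2 (evenPart mu sigma s) u) t
      - mu^2 * iteratedDeriv 2 (evenPart mu sigma t) u
      + sigma^4 / 4 * iteratedDeriv 4 (evenPart mu sigma t) u = 0 := by
  have hD (m : ℝ) (n : ℕ) {s : ℝ} (hs : 0 < s) :=
    hasDerivAt_driftDensityDeriv_time m hsigma hs u n
  have hfirst : deriv (fun s => evenPart mu sigma s u) =ᶠ[nhds t] fun s =>
      ((-mu * driftDensityDeriv mu sigma s u 1 + sigma^2 / 2 * driftDensityDeriv mu sigma s u 2)
        + (-(-mu) * driftDensityDeriv (-mu) sigma s u 1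
          + sigma^2 / 2 * driftDensityDeriv (-mu) sigma s u 2)) / 2 := by
    filter_upwards [lt_mem_nhds ht] with s hs
    simp only [evenPart, driftDensity_neg]
    exact (((hD mu 0 hs).add (hD (-mu) 0 hs)).div_const 2).deriv
  have htt := (((((hD mu 1 ht).const_mul (-mu)).add ((hD mu 2 ht).const_mul (sigma^2 / 2))).add
    (((hD (-mu) 1 ht).const_mul (-(-mu))).add
      ((hD (-mu) 2 ht).const_mul (sigma^2 / 2)))).div_const 2).deriv
  have htuu := (((hD mu 2 ht).add (hD (-mu) 2 ht)).div_const 2).deriv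
  rw [iteratedDeriv_succ, iteratedDeriv_one, hfirst.deriv_eq]
  simp only [iteratedDeriv_evenPart]
  erw [htt, htuu]
  ring
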